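/- arXiv:2507.15505 — 5 statements merged into one kernel-verified Lean document; each statement's English description precedes it below -/
import Mathlib

section
/- Let r be a positive integer with r ≢ 0 (mod p) and r ≢ −1 (mod p). Suppose ε: V → K is a surjective homomorphism of KG-modules (K the trivial module). If there is a KG-module homomorphism φ: Sym^{r−1} V → Sym^r V with ∂_r ∘ φ = id, then there is a KG-module homomorphism θ: Sym^r V → Sym^{r+1} V with ∂_{r+1} ∘ θ = id. -/
open MvPolynomial

/-- The derivation `∂ = Σ_i ε(x_i)·∂/∂x_i` on `K[x_1,…,x_t]`, where `c i = ε(x_i)`. -/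
noncomputable def Dc {K : Type*} [Field K] {t : ℕ} (c : Fin t → K) :
    MvPolynomial (Fin t) K →ₗ[K] MvPolynomial (Fin t) K :=
  ∑ i, c i • (pderiv i).toLinearMap

section Polynomials

variable {K : Type*} [Field K] {t : ℕ}

theorem Dc_apply (c : Fin t → K) (f : MvPolynomial (Fin t) K) :
    Dc c f = ∑ i, c i • pderiv i f := by
  simp [Dc]

theorem Dc_mul (c : Fin t → K) (f h : MvPolynomial (Fin t) K) :
    Dc c (f * h) = f * Dc c h + h * Dc c f := by
  simp only [Dc_apply, Derivation.leibniz, smul_eq_mul, smul_add, Finset.sum_add_distrib,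
    Finset.mul_sum, mul_smul_comm]

theorem Dc_X (c : Fin t → K) (i : Fin t) : Dc c (X i) = C (c i) := by
  simp [Dc_apply, pderiv_X, Pi.single_apply, smul_eq_C_mul]

theorem Dc_isHomogeneous (c : Fin t → K) {n : ℕ} {f : MvPolynomial (Fin t) K}
    (hf : f.IsHomogeneous n) : (Dc c f).IsHomogeneous (n - 1) := by
  rw [Dc_apply]
  exact IsHomogeneous.sum _ _ _ fun i _ =>
    (homogeneousSubmodule (Fin t) K (n - 1)).smul_mem _ hf.pderiv

/-- A linear form is determined by its constant partial derivatives. -/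
theorem exists_coeff_of_isHomogeneous_one {f : MvPolynomial (Fin t) K}
    (hf : f.IsHomogeneous 1) :
    ∃ a : Fin t → K, (∀ i, pderiv i f = C (a i)) ∧ f = ∑ i, a i • X i := by
  have hconst (i : Fin t) : pderiv i f = C (coeff 0 (pderiv i f)) :=
    totalDegree_eq_zero_iff_eq_C.mp ((totalDegree_zero_iff_isHomogeneous _).mpr hf.pderiv)
  refine ⟨fun i => coeff 0 (pderiv i f), hconst, ?_⟩
  have euler := hf.sum_X_mul_pderiv
  rw [one_smul] at euler
  conv_lhs => rw [← euler]
  refine Finset.sum_congr rfl fun i _ => ?_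
  rw [smul_eq_C_mul, ← hconst i, mul_comm]

/-- The chain rule for an endomorphism of a polynomial ring. -/
theorem pderiv_algHom (s : MvPolynomial (Fin t) K →ₐ[K] MvPolynomial (Fin t) K) (i : Fin t)
    (f : MvPolynomial (Fin t) K) :
    pderiv i (s f) = ∑ j, s (pderiv j f) * pderiv i (s (X j)) := by
  induction f using MvPolynomial.induction_on with
  | C a => simp [← algebraMap_eq]
  | add f h hf hh => simp [hf, hh, add_mul, Finset.sum_add_distrib]
  | mul_X f k hf =>
    simp only [map_mul, Derivation.leibniz, hf, smul_eq_mul, map_add, add_mul,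
      Finset.sum_add_distrib, Finset.mul_sum, pderiv_X, Pi.single_apply]
    simp [mul_assoc, apply_ite s, ite_mul]

theorem algHom_isHomogeneous {s : MvPolynomial (Fin t) K →ₐ[K] MvPolynomial (Fin t) K}
    (hs : ∀ i, (s (X i)).IsHomogeneous 1) {n : ℕ} {f : MvPolynomial (Fin t) K}
    (hf : f.IsHomogeneous n) : (s f).IsHomogeneous n := by
  rw [aeval_unique s]
  simpa using hf.aeval (s ∘ X) hs

/-- `∂` commutes with linear substitutions that preserve the linear form `ε`. -/
theorem Dc_algHom {c : Fin t → K} {s : MvPolynomial (Fin t) K →ₐ[K] MvPolynomial (Fin t) K}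
    (hs : ∀ i, (s (X i)).IsHomogeneous 1) (hc : ∀ i, aeval c (s (X i)) = c i)
    (f : MvPolynomial (Fin t) K) : Dc c (s f) = s (Dc c f) := by
  have hX (j : Fin t) : Dc c (s (X j)) = C (c j) := by
    obtain ⟨a, hda, ha⟩ := exists_coeff_of_isHomogeneous_one (hs j)
    have hcj : c j = ∑ i, c i * a i := by
      rw [← hc j, ha]
      simp [mul_comm]
    simp only [Dc_apply, hda, hcj, map_sum, map_mul, smul_eq_C_mul]
  have hchain (i : Fin t) := pderiv_algHom s i f
  simp only [Dc_apply c (s f), hchain, Finset.smul_sum]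
  rw [Finset.sum_comm, Dc_apply, map_sum]
  refine Finset.sum_congr rfl fun j _ => ?_
  rw [map_smul, smul_eq_C_mul, ← hX, Dc_apply, Finset.sum_mul]
  refine Finset.sum_congr rfl fun i _ => ?_
  rw [smul_mul_assoc, mul_comm]

/-- The map `f ↦ Σ_i x_i φ(∂f/∂x_i)`: polarise `f` into `V ⊗ Sym^{r-1} V`, apply `φ` to the
second factor, and multiply. -/
noncomputable def polarizedMap
    (φ : MvPolynomial (Fin t) K →ₗ[K] MvPolynomial (Fin t) K) :
    MvPolynomial (Fin t) K →ₗ[K] MvPolynomial (Fin t) K :=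
  ∑ i, LinearMap.mulLeft K (X i) ∘ₗ φ ∘ₗ (pderiv i).toLinearMap

variable {φ : MvPolynomial (Fin t) K →ₗ[K] MvPolynomial (Fin t) K}

theorem polarizedMap_apply (φ : MvPolynomial (Fin t) K →ₗ[K] MvPolynomial (Fin t) K)
    (f : MvPolynomial (Fin t) K) : polarizedMap φ f = ∑ i, X i * φ (pderiv i f) := by
  simp [polarizedMap]

theorem polarizedMap_isHomogeneous {r : ℕ}
    (hφ : ∀ f ∈ homogeneousSubmodule (Fin t) K (r - 1),
      φ f ∈ homogeneousSubmodule (Fin t) K r)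
    {f : MvPolynomial (Fin t) K} (hf : f.IsHomogeneous r) :
    (polarizedMap φ f).IsHomogeneous (r + 1) := by
  rw [polarizedMap_apply, add_comm]
  exact IsHomogeneous.sum _ _ _ fun i _ => (isHomogeneous_X K i).mul (hφ _ hf.pderiv)

theorem polarizedMap_algHom {s : MvPolynomial (Fin t) K →ₐ[K] MvPolynomial (Fin t) K}
    (hs : ∀ i, (s (X i)).IsHomogeneous 1) {r : ℕ}
    (hφ : ∀ f ∈ homogeneousSubmodule (Fin t) K (r - 1), φ (s f) = s (φ f))
    {f : MvPolynomial (Fin t) K} (hf : f.IsHomogeneous r) :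
    polarizedMap φ (s f) = s (polarizedMap φ f) := by
  choose a hda ha using fun j => exists_coeff_of_isHomogeneous_one (hs j)
  have hφ' (j : Fin t) : φ (s (pderiv j f)) = s (φ (pderiv j f)) := hφ _ hf.pderiv
  have hchain (i : Fin t) := pderiv_algHom s i f
  simp only [polarizedMap_apply, hchain, hda, map_sum, Finset.mul_sum, map_mul]
  rw [Finset.sum_comm]
  refine Finset.sum_congr rfl fun j _ => ?_
  rw [ha j, Finset.sum_mul]
  refine Finset.sum_congr rfl fun i _ => ?_
  rw [mul_comm _ (C _), ← smul_eq_C_mul, map_smul, hφ', smul_mul_assoc, mul_smul_comm]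

theorem Dc_polarizedMap {c : Fin t → K} {r : ℕ}
    (hφ : ∀ f ∈ homogeneousSubmodule (Fin t) K (r - 1), Dc c (φ f) = f)
    {f : MvPolynomial (Fin t) K} (hf : f.IsHomogeneous r) :
    Dc c (polarizedMap φ f) = φ (Dc c f) + (r : K) • f := by
  have hφ' (i : Fin t) : Dc c (φ (pderiv i f)) = pderiv i f := hφ _ hf.pderiv
  simp only [polarizedMap_apply, map_sum, Dc_mul, hφ', Dc_X, Finset.sum_add_distrib,
    hf.sum_X_mul_pderiv, Dc_apply c f, map_smul]
  rw [add_comm, Nat.cast_smul_eq_nsmul]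
  simp [smul_eq_C_mul, mul_comm]

end Polynomials

theorem stmt0 {K : Type*} [Field K] {p : ℕ} (hp : p.Prime) [CharP K p]
    {G : Type*} [Group G] {t : ℕ}
    (ρ : G →* (MvPolynomial (Fin t) K ≃ₐ[K] MvPolynomial (Fin t) K))
    (hρ : ∀ (g : G) (i : Fin t), (ρ g) (X i) ∈ homogeneousSubmodule (Fin t) K 1)
    (c : Fin t → K)
    (hsurj : Function.Surjective fun v : homogeneousSubmodule (Fin t) K 1 =>
      aeval c (v : MvPolynomial (Fin t) K))
    (hequiv : ∀ (g : G), ∀ f ∈ homogeneousSubmodule (Fin t) K 1,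
      aeval c ((ρ g) f) = aeval c f)
    {r : ℕ} (hr : 0 < r) (hr0 : ¬ p ∣ r) (hr1 : ¬ p ∣ (r + 1))
    (φ : MvPolynomial (Fin t) K →ₗ[K] MvPolynomial (Fin t) K)
    (hφmem : ∀ f ∈ homogeneousSubmodule (Fin t) K (r - 1),
      φ f ∈ homogeneousSubmodule (Fin t) K r)
    (hφequiv : ∀ (g : G), ∀ f ∈ homogeneousSubmodule (Fin t) K (r - 1),
      φ ((ρ g) f) = (ρ g) (φ f))
    (hφsplit : ∀ f ∈ homogeneousSubmodule (Fin t) K (r - 1), Dc c (φ f) = f) :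
    ∃ θ : MvPolynomial (Fin t) K →ₗ[K] MvPolynomial (Fin t) K,
      (∀ f ∈ homogeneousSubmodule (Fin t) K r,
        θ f ∈ homogeneousSubmodule (Fin t) K (r + 1)) ∧
      (∀ (g : G), ∀ f ∈ homogeneousSubmodule (Fin t) K r, θ ((ρ g) f) = (ρ g) (θ f)) ∧
      (∀ f ∈ homogeneousSubmodule (Fin t) K r, Dc c (θ f) = f) := by
  have hr0' : (r : K) ≠ 0 := fun h => hr0 ((CharP.cast_eq_zero_iff K p r).mp h)
  have hr1' : (r : K) + 1 ≠ 0 := fun h =>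
    hr1 ((CharP.cast_eq_zero_iff K p (r + 1)).mp (by exact_mod_cast h))
  have hDmem {f : MvPolynomial (Fin t) K} (hf : f.IsHomogeneous r) :
      Dc c f ∈ homogeneousSubmodule (Fin t) K (r - 1) := Dc_isHomogeneous c hf
  have hDequiv (g : G) (f : MvPolynomial (Fin t) K) : Dc c (ρ g f) = ρ g (Dc c f) :=
    Dc_algHom (s := (ρ g : MvPolynomial (Fin t) K →ₐ[K] MvPolynomial (Fin t) K)) (hρ g)
      (fun i => (hequiv g (X i) (isHomogeneous_X K i)).trans (aeval_X c i)) f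
  -- `u` is the inverse of `r + φ ∘ ∂` on degree `r`, as `φ ∘ ∂` is idempotent there
  let u : MvPolynomial (Fin t) K →ₗ[K] MvPolynomial (Fin t) K :=
    (r : K)⁻¹ • (LinearMap.id - ((r : K) + 1)⁻¹ • (φ ∘ₗ Dc c))
  have hu (f : MvPolynomial (Fin t) K) :
      u f = (r : K)⁻¹ • (f - ((r : K) + 1)⁻¹ • φ (Dc c f)) := rfl
  have humem {f : MvPolynomial (Fin t) K} (hf : f.IsHomogeneous r) : (u f).IsHomogeneous r :=
    Submodule.smul_mem _ _ (Submodule.sub_mem _ hf (Submodule.smul_mem _ _ (hφmem _ (hDmem hf))))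
  refine ⟨polarizedMap φ ∘ₗ u, fun f hf => polarizedMap_isHomogeneous hφmem (humem hf),
    fun g f hf => ?_, fun f hf => ?_⟩
  · have hug : u (ρ g f) = ρ g (u f) := by
      simp only [hu, hDequiv, hφequiv g _ (hDmem hf), map_smul, map_sub]
    rw [LinearMap.comp_apply, LinearMap.comp_apply, hug]
    exact polarizedMap_algHom
      (s := (ρ g : MvPolynomial (Fin t) K →ₐ[K] MvPolynomial (Fin t) K)) (hρ g) (hφequiv g)
      (humem hf)
  · rw [LinearMap.comp_apply, Dc_polarizedMap hφsplit (humem hf), hu]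
    simp only [map_smul, map_sub, hφsplit _ (hDmem hf)]
    match_scalars <;> field_simp
    ring
end

section
/- Let V be a permutation KG-module with permutation basis x_1, …, x_t, and let ε: V → K be the KG-homomorphism sending every x_i to 1. Then for every r with 2 ≤ r ≤ p−1 there exists a KG-module homomorphism θ: Sym^{r−1} V → Sym^r V with ∂_r ∘ θ = id; in particular, Sym^{r−1} V is isomorphic to a direct summand of Sym^r V. -/
open MvPolynomial

/-- The derivation `∂ = Σ_i ∂/∂x_i` on `K[x_1,…,x_t]`. -/
noncomputable def Done (K : Type*) [Field K] (t : ℕ) :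
    MvPolynomial (Fin t) K →ₗ[K] MvPolynomial (Fin t) K :=
  ∑ i, (pderiv i).toLinearMap

namespace MvPolynomial

section MonomialOperators

variable {σ K : Type*} [Field K]

/-- The linear operator sending the monomial `x^m` to `c m • x^(φ m)`. -/
noncomputable def weightedShift (c : (σ →₀ ℕ) → K) (φ : (σ →₀ ℕ) → (σ →₀ ℕ)) :
    Module.End K (MvPolynomial σ K) :=
  (basisMonomials σ K).constr K fun m => monomial (φ m) (c m)

lemma weightedShift_monomial (c : (σ →₀ ℕ) → K) (φ : (σ →₀ ℕ) → (σ →₀ ℕ))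
    (m : σ →₀ ℕ) (a : K) :
    weightedShift c φ (monomial m a) = monomial (φ m) (a * c m) := by
  have h : weightedShift c φ (monomial m 1) = monomial (φ m) (c m) := by
    simpa [weightedShift] using
      (basisMonomials σ K).constr_basis K (fun m => monomial (φ m) (c m)) m
  have ha : monomial m a = a • monomial m (1 : K) := by simp [smul_monomial]
  rw [ha, map_smul, h, smul_monomial, smul_eq_mul]

/-- Membership of the image of a polynomial in a submodule can be checked on monomials. -/
lemma map_mem_of_monomial {S : Set (σ →₀ ℕ)} {N : Submodule K (MvPolynomial σ K)}
    (L : Module.End K (MvPolynomial σ K)) (h : ∀ m ∈ S, L (monomial m 1) ∈ N)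
    {f : MvPolynomial σ K} (hf : f ∈ restrictSupport K S) : L f ∈ N := by
  rw [restrictSupport_eq_span] at hf
  have : Submodule.span K ((monomial · (1 : K)) '' S) ≤ N.comap L := by
    rw [Submodule.span_le]
    rintro _ ⟨m, hm, rfl⟩
    exact h m hm
  exact this hf

lemma weightedShift_mem {S S' : Set (σ →₀ ℕ)} {c : (σ →₀ ℕ) → K}
    {φ : (σ →₀ ℕ) → (σ →₀ ℕ)} (h : ∀ m ∈ S, c m ≠ 0 → φ m ∈ S')
    {f : MvPolynomial σ K} (hf : f ∈ restrictSupport K S) :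
    weightedShift c φ f ∈ restrictSupport K S' := by
  refine map_mem_of_monomial _ (fun m hm => ?_) hf
  rw [weightedShift_monomial, monomial_mem_restrictSupport, one_mul]
  by_cases hc : c m = 0
  · exact Or.inr hc
  · exact Or.inl (h m hm hc)

lemma homogeneousSubmodule_eq_restrictSupport (n : ℕ) :
    homogeneousSubmodule σ K n = restrictSupport K {m | m.degree = n} :=
  homogeneousSubmodule_eq_finsupp_supported σ K n

variable (K) in
/-- The part of `∂/∂x_i` that keeps `x_i` in the support of a monomial. -/
noncomputable def pderivKeep (i : σ) : Module.End K (MvPolynomial σ K) :=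
  weightedShift (fun m => if 2 ≤ m i then (m i : K) else 0) fun m => m - Finsupp.single i 1

variable (K) in
/-- The part of `∂/∂x_i` that removes `x_i` from the support of a monomial. -/
noncomputable def pderivDrop (i : σ) : Module.End K (MvPolynomial σ K) :=
  weightedShift (fun m => if m i = 1 then 1 else 0) fun m => m - Finsupp.single i 1

variable (K) in
/-- Sends `x^m` to `m_i / ((m_i + 1) s) x_i x^m`, where `s` is the number of variables
occurring in `x^m`. -/
noncomputable def supportedIntegral (i : σ) : Module.End K (MvPolynomial σ K) :=
  weightedShift (fun m => (m i : K) * ((m i : K) + 1)⁻¹ * (m.support.card : K)⁻¹)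
    fun m => m + Finsupp.single i 1

lemma pderivKeep_add_pderivDrop (i : σ) :
    pderivKeep K i + pderivDrop K i = (pderiv i).toLinearMap := by
  refine (basisMonomials σ K).ext fun m => ?_
  simp only [coe_basisMonomials, LinearMap.add_apply, pderivKeep, pderivDrop,
    weightedShift_monomial, ← map_add]
  change _ = pderiv i (monomial m 1)
  rw [pderiv_monomial]
  congr 1
  rcases Nat.lt_or_ge (m i) 2 with h | h
  · interval_cases m i <;> simp
  · have : m i ≠ 1 := by omega
    simp [h, this]

lemma support_sub_single {m : σ →₀ ℕ} {i : σ} (h : 2 ≤ m i) :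
    (m - Finsupp.single i 1).support = m.support := by
  classical
  ext j
  by_cases hj : i = j
  · subst hj
    simp
    omega
  · simp [hj]

lemma support_add_single {m : σ →₀ ℕ} {i : σ} (h : m i ≠ 0) :
    (m + Finsupp.single i 1).support = m.support := by
  classical
  ext j
  by_cases hj : i = j
  · subst hj
    simp [h]
  · simp [hj]

lemma degree_sub_single {m : σ →₀ ℕ} {i : σ} (h : m i ≠ 0) :
    (m - Finsupp.single i 1).degree + 1 = m.degree := by
  have hle : Finsupp.single i 1 ≤ m := by
    rw [Finsupp.single_le_iff]
    omega
  conv_rhs => rw [← tsub_add_cancel_of_le hle]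
  simp

variable (K) in
/-- The polynomials all of whose monomials involve at most `s` distinct variables. -/
noncomputable def supportFiltration (σ : Type*) (s : ℕ) : Submodule K (MvPolynomial σ K) :=
  restrictSupport K {m | m.support.card ≤ s}

lemma pderivKeep_mem_filtration (i : σ) (s : ℕ) {f : MvPolynomial σ K}
    (hf : f ∈ supportFiltration K σ s) : pderivKeep K i f ∈ supportFiltration K σ s := by
  refine weightedShift_mem (fun m hm hc => ?_) hf
  have h : 2 ≤ m i := by
    by_contra h
    simp [h] at hc
  simpa [support_sub_single h] using hm

lemma supportedIntegral_mem_filtration (i : σ) (s : ℕ) {f : MvPolynomial σ K}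
    (hf : f ∈ supportFiltration K σ s) : supportedIntegral K i f ∈ supportFiltration K σ s := by
  refine weightedShift_mem (fun m hm hc => ?_) hf
  have h : m i ≠ 0 := by
    intro h
    simp [h] at hc
  simpa [support_add_single h] using hm

lemma pderivDrop_mem_filtration (i : σ) (s : ℕ) {f : MvPolynomial σ K}
    (hf : f ∈ supportFiltration K σ (s + 1)) : pderivDrop K i f ∈ supportFiltration K σ s := by
  classical
  refine weightedShift_mem (fun m hm hc => ?_) hf
  have h : m i = 1 := by
    by_contra h
    simp [h] at hc
  have hsub : (m - Finsupp.single i 1).support ⊆ m.support.erase i := by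
    intro j hj
    by_cases hij : i = j
    · subst hij
      simp [h] at hj
    · simpa [Finsupp.single_apply, hij, Ne.symm hij] using hj
  have hi : i ∈ m.support := by simp [h]
  have hcard := Finset.card_le_card hsub
  rw [Finset.card_erase_of_mem hi] at hcard
  simp only [Set.mem_ofPred_eq] at hm ⊢
  omega

lemma pderivDrop_eq_zero (i : σ) {f : MvPolynomial σ K}
    (hf : f ∈ supportFiltration K σ 0) : pderivDrop K i f = 0 := by
  rw [← Submodule.mem_bot K]
  refine map_mem_of_monomial _ (fun m hm => ?_) hf
  have hm : m = 0 := by simpa using hm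
  rw [pderivDrop, weightedShift_monomial]
  simp [hm]

lemma pderivKeep_mem_degree (i : σ) (n : ℕ) {f : MvPolynomial σ K}
    (hf : f ∈ homogeneousSubmodule σ K (n + 1)) :
    pderivKeep K i f ∈ homogeneousSubmodule σ K n := by
  rw [homogeneousSubmodule_eq_restrictSupport] at hf ⊢
  refine weightedShift_mem (fun m hm hc => ?_) hf
  have h : m i ≠ 0 := by
    intro h
    simp [h] at hc
  have := degree_sub_single h
  simp only [Set.mem_ofPred_eq] at hm ⊢
  omega

lemma pderivDrop_mem_degree (i : σ) (n : ℕ) {f : MvPolynomial σ K}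
    (hf : f ∈ homogeneousSubmodule σ K (n + 1)) :
    pderivDrop K i f ∈ homogeneousSubmodule σ K n := by
  rw [homogeneousSubmodule_eq_restrictSupport] at hf ⊢
  refine weightedShift_mem (fun m hm hc => ?_) hf
  have h : m i ≠ 0 := by
    intro h
    simp [h] at hc
  have := degree_sub_single h
  simp only [Set.mem_ofPred_eq] at hm ⊢
  omega

lemma pderivKeep_eq_zero (i : σ) {f : MvPolynomial σ K}
    (hf : f ∈ homogeneousSubmodule σ K 1) : pderivKeep K i f = 0 := by
  rw [homogeneousSubmodule_eq_restrictSupport] at hf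
  rw [← Submodule.mem_bot K]
  refine map_mem_of_monomial _ (fun m hm => ?_) hf
  have h : ¬ 2 ≤ m i := by
    have := Finsupp.le_degree i m
    simp only [Set.mem_ofPred_eq] at hm
    omega
  simp [pderivKeep, weightedShift_monomial, h]

lemma supportedIntegral_mem_degree (i : σ) (n : ℕ) {f : MvPolynomial σ K}
    (hf : f ∈ homogeneousSubmodule σ K n) :
    supportedIntegral K i f ∈ homogeneousSubmodule σ K (n + 1) := by
  rw [homogeneousSubmodule_eq_restrictSupport] at hf ⊢
  refine weightedShift_mem (fun m hm _ => ?_) hf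
  simp only [Set.mem_ofPred_eq] at hm ⊢
  simp [hm]

lemma pderivKeep_supportedIntegral_monomial [DecidableEq σ] {m : σ →₀ ℕ}
    (hm : ∀ i, (m i : K) + 1 ≠ 0) (hm' : ∀ i, m i ≠ 0 → (m i : K) ≠ 0) (i j : σ) :
    pderivKeep K i (supportedIntegral K j (monomial m 1)) =
      supportedIntegral K j (pderivKeep K i (monomial m 1)) +
        if i = j then monomial m (if m i = 0 then 0 else (m.support.card : K)⁻¹) else 0 := by
  simp only [pderivKeep, supportedIntegral, weightedShift_monomial]
  by_cases hij : i = j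
  · subst hij
    have e : m + Finsupp.single i 1 - Finsupp.single i 1 = m := by simp
    rcases Nat.lt_or_ge (m i) 2 with h | h
    · rcases Nat.lt_or_ge (m i) 1 with h1 | h1
      · have : m i = 0 := by omega
        simp [this]
      · have h1 : m i = 1 := by omega
        have := hm i
        simp only [h1, e, Nat.cast_one] at this ⊢
        simp only [Finsupp.coe_add, Pi.add_apply, Finsupp.single_eq_same, h1]
        norm_num
        congr 1
        rw [one_add_one_eq_two] at this
        field_simp
    · have e' : m - Finsupp.single i 1 + Finsupp.single i 1 = m :=
        tsub_add_cancel_of_le (by rw [Finsupp.single_le_iff]; omega)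
      have h0 : m i ≠ 0 := by omega
      have h2 : 2 ≤ m i + 1 := by omega
      have h3 := hm i
      have h4 := hm' i h0
      rw [e, e', support_sub_single h]
      simp only [Finsupp.coe_add, Finsupp.coe_tsub, Pi.add_apply, Pi.sub_apply,
        Finsupp.single_eq_same, if_pos h, if_pos h2, if_neg h0, if_true, ← map_add]
      congr 1
      rw [Nat.cast_sub (by omega)]
      push_cast
      rw [sub_add_cancel]
      field_simp
      ring
  · have e1 : (m + Finsupp.single j 1 : σ →₀ ℕ) i = m i := by simp [Ne.symm hij]
    have e2 : (m - Finsupp.single i 1 : σ →₀ ℕ) j = m j := by simp [hij]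
    rw [e1, e2, if_neg hij, add_zero]
    by_cases h : 2 ≤ m i
    · rw [if_pos h, support_sub_single h]
      have e : m + Finsupp.single j 1 - Finsupp.single i 1 =
          m - Finsupp.single i 1 + Finsupp.single j 1 :=
        tsub_add_eq_add_tsub (by rw [Finsupp.single_le_iff]; omega) |>.symm
      rw [e]
      congr 1
      ring
    · simp [h]

end MonomialOperators

section SupportPreserving

variable {σ K : Type*} [Field K] [Fintype σ]

variable (K) in
/-- The part of `∑ ∂/∂x_i` that preserves the support of each monomial. -/
noncomputable def derivKeep (σ : Type*) [Fintype σ] : Module.End K (MvPolynomial σ K) :=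
  ∑ i, pderivKeep K i

variable (K) in
/-- The part of `∑ ∂/∂x_i` that shrinks the support of each monomial. -/
noncomputable def derivDrop (σ : Type*) [Fintype σ] : Module.End K (MvPolynomial σ K) :=
  ∑ i, pderivDrop K i

variable (K) in
/-- A support-preserving operator of degree one, whose commutator with `derivKeep` is the
identity in low positive degrees. -/
noncomputable def raiseKeep (σ : Type*) [Fintype σ] : Module.End K (MvPolynomial σ K) :=
  ∑ i, supportedIntegral K i

lemma derivKeep_raiseKeep {p : ℕ} [CharP K p] {n : ℕ} (hn : 1 ≤ n) (hnp : n + 1 < p)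
    {f : MvPolynomial σ K} (hf : f ∈ homogeneousSubmodule σ K n) :
    derivKeep K σ (raiseKeep K σ f) = raiseKeep K σ (derivKeep K σ f) + f := by
  classical
  have hcast : ∀ k : ℕ, k ≠ 0 → k < p → (k : K) ≠ 0 := fun k hk hkp h =>
    hk (Nat.eq_zero_of_dvd_of_lt ((CharP.cast_eq_zero_iff K p k).1 h) hkp)
  rw [homogeneousSubmodule_eq_restrictSupport] at hf
  suffices h : (derivKeep K σ * raiseKeep K σ - raiseKeep K σ * derivKeep K σ - 1) f ∈
      (⊥ : Submodule K (MvPolynomial σ K)) by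
    rw [Submodule.mem_bot] at h
    simp only [LinearMap.sub_apply, Module.End.mul_apply, Module.End.one_apply] at h
    rw [← sub_eq_zero, ← h]
    abel
  refine map_mem_of_monomial _ (fun m hm => ?_) hf
  simp only [Set.mem_ofPred_eq] at hm
  have hle : ∀ i, m i ≤ n := fun i => hm ▸ Finsupp.le_degree i m
  have h1 : ∀ i, (m i : K) + 1 ≠ 0 := fun i => by
    have := hcast (m i + 1) (by omega) (by have := hle i; omega)
    simpa using this
  have h2 : ∀ i, m i ≠ 0 → (m i : K) ≠ 0 := fun i hi =>
    hcast _ hi (by have := hle i; omega)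
  have hs : m.support.card ≤ n := by
    rw [← hm, Finsupp.degree, Finset.card_eq_sum_ones]
    exact Finset.sum_le_sum fun i hi => Nat.one_le_iff_ne_zero.2 (Finsupp.mem_support_iff.1 hi)
  have hs0 : m.support.card ≠ 0 := by
    intro h
    have : m = 0 := by simpa using h
    simp [this] at hm
    omega
  have h3 : (m.support.card : K) ≠ 0 := hcast _ hs0 (by omega)
  have hsum : ∑ i, (if m i = 0 then 0 else (m.support.card : K)⁻¹) = 1 := by
    have : (Finset.univ.filter fun i => ¬ m i = 0) = m.support := by
      ext i
      simp
    rw [Finset.sum_ite, Finset.sum_const_zero, zero_add, Finset.sum_const, this, nsmul_eq_mul,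
      mul_inv_cancel₀ h3]
  rw [Submodule.mem_bot]
  simp only [LinearMap.sub_apply, Module.End.mul_apply, Module.End.one_apply, derivKeep, raiseKeep,
    LinearMap.sum_apply, map_sum, pderivKeep_supportedIntegral_monomial h1 h2,
    Finset.sum_add_distrib, Finset.sum_ite_eq', Finset.mem_univ, if_true]
  rw [Finset.sum_comm, ← map_sum, hsum]
  abel

lemma derivKeep_add_derivDrop :
    derivKeep K σ + derivDrop K σ = ∑ i : σ, (pderiv i).toLinearMap := by
  simp only [derivKeep, derivDrop, ← Finset.sum_add_distrib, pderivKeep_add_pderivDrop]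

lemma derivKeep_mem_degree (n : ℕ) {f : MvPolynomial σ K}
    (hf : f ∈ homogeneousSubmodule σ K (n + 1)) :
    derivKeep K σ f ∈ homogeneousSubmodule σ K n := by
  rw [derivKeep, LinearMap.sum_apply]
  exact Submodule.sum_mem _ fun i _ => pderivKeep_mem_degree i n hf

lemma derivKeep_eq_zero {f : MvPolynomial σ K} (hf : f ∈ homogeneousSubmodule σ K 1) :
    derivKeep K σ f = 0 := by
  rw [derivKeep, LinearMap.sum_apply]
  exact Finset.sum_eq_zero fun i _ => pderivKeep_eq_zero i hf

lemma derivDrop_mem_degree (n : ℕ) {f : MvPolynomial σ K}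
    (hf : f ∈ homogeneousSubmodule σ K (n + 1)) :
    derivDrop K σ f ∈ homogeneousSubmodule σ K n := by
  rw [derivDrop, LinearMap.sum_apply]
  exact Submodule.sum_mem _ fun i _ => pderivDrop_mem_degree i n hf

lemma derivKeep_pow_mem_degree (n k : ℕ) {f : MvPolynomial σ K}
    (hf : f ∈ homogeneousSubmodule σ K (n + k)) :
    (derivKeep K σ ^ k) f ∈ homogeneousSubmodule σ K n := by
  induction k generalizing f with
  | zero => simpa using hf
  | succ k ih =>
    rw [pow_succ, Module.End.mul_apply]
    exact ih (derivKeep_mem_degree _ hf)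

lemma raiseKeep_pow_mem_degree (n k : ℕ) {f : MvPolynomial σ K}
    (hf : f ∈ homogeneousSubmodule σ K n) :
    (raiseKeep K σ ^ k) f ∈ homogeneousSubmodule σ K (n + k) := by
  induction k with
  | zero => simpa using hf
  | succ k ih =>
    rw [pow_succ', Module.End.mul_apply, raiseKeep, LinearMap.sum_apply]
    exact Submodule.sum_mem _ fun i _ => supportedIntegral_mem_degree i _ ih

lemma derivKeep_raiseKeep_pow {p : ℕ} [CharP K p] {n k : ℕ} (hn : 1 ≤ n) (hnp : n + k + 1 < p)
    {f : MvPolynomial σ K} (hf : f ∈ homogeneousSubmodule σ K n) :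
    derivKeep K σ ((raiseKeep K σ ^ (k + 1)) f) =
      (raiseKeep K σ ^ (k + 1)) (derivKeep K σ f) + ((k : K) + 1) • (raiseKeep K σ ^ k) f := by
  induction k with
  | zero => simpa using derivKeep_raiseKeep hn hnp hf
  | succ k ih =>
    rw [pow_succ' _ (k + 1), Module.End.mul_apply, Module.End.mul_apply,
      derivKeep_raiseKeep (by omega) hnp (raiseKeep_pow_mem_degree n (k + 1) hf),
      ih (by omega), map_add, map_smul,
      ← Module.End.mul_apply _ (raiseKeep K σ ^ k) f, ← pow_succ' _ k]
    push_cast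
    module

variable (K) in
/-- A right inverse of `derivKeep` on homogeneous polynomials of degree `d`, obtained by repeated
integration by parts. -/
noncomputable def integralKeep (σ : Type*) [Fintype σ] (d : ℕ) :
    Module.End K (MvPolynomial σ K) :=
  ∑ k ∈ Finset.range d, ((-1) ^ k * ((k + 1).factorial : K)⁻¹) •
    (raiseKeep K σ ^ (k + 1) * derivKeep K σ ^ k)

lemma derivKeep_integralKeep {p : ℕ} [CharP K p] (hp : p.Prime) {d : ℕ} (hd : 1 ≤ d)
    (hdp : d + 1 < p) {f : MvPolynomial σ K} (hf : f ∈ homogeneousSubmodule σ K d) :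
    derivKeep K σ (integralKeep K σ d f) = f := by
  let a : ℕ → MvPolynomial σ K := fun k =>
    ((-1) ^ k * (k.factorial : K)⁻¹) • (raiseKeep K σ ^ k) ((derivKeep K σ ^ k) f)
  have hterm : ∀ k ∈ Finset.range d,
      ((-1) ^ k * ((k + 1).factorial : K)⁻¹) •
        derivKeep K σ ((raiseKeep K σ ^ (k + 1)) ((derivKeep K σ ^ k) f)) = a k - a (k + 1) := by
    intro k hk
    rw [Finset.mem_range] at hk
    have hfk : (derivKeep K σ ^ k) f ∈ homogeneousSubmodule σ K (d - k) :=
      derivKeep_pow_mem_degree _ k (by rwa [Nat.sub_add_cancel hk.le])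
    have hfac : ((k + 1).factorial : K) ≠ 0 := by
      rw [Ne, CharP.cast_eq_zero_iff K p, hp.dvd_factorial]
      omega
    rw [derivKeep_raiseKeep_pow (p := p) (by omega) (by omega) hfk]
    simp only [a]
    rw [← Module.End.mul_apply (derivKeep K σ), ← pow_succ', smul_add, smul_smul, add_comm,
      sub_eq_add_neg, ← neg_smul]
    rw [Nat.factorial_succ] at hfac ⊢
    push_cast at hfac ⊢
    have h1 := left_ne_zero_of_mul hfac
    have h2 := right_ne_zero_of_mul hfac
    congr 2
    · field_simp
    · ring
  have hlast : (derivKeep K σ ^ d) f = 0 := by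
    obtain ⟨e, rfl⟩ := Nat.exists_eq_add_of_le hd
    rw [add_comm, pow_succ', Module.End.mul_apply]
    exact derivKeep_eq_zero (derivKeep_pow_mem_degree 1 e hf)
  simp only [integralKeep, LinearMap.sum_apply, LinearMap.smul_apply, Module.End.mul_apply, map_sum,
    map_smul]
  rw [Finset.sum_congr rfl hterm, Finset.sum_range_sub']
  simp [a, hlast]

lemma integralKeep_mem_degree {d : ℕ} {f : MvPolynomial σ K}
    (hf : f ∈ homogeneousSubmodule σ K d) :
    integralKeep K σ d f ∈ homogeneousSubmodule σ K (d + 1) := by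
  rw [integralKeep, LinearMap.sum_apply]
  refine Submodule.sum_mem _ fun k hk => ?_
  rw [Finset.mem_range] at hk
  rw [LinearMap.smul_apply, Module.End.mul_apply]
  refine Submodule.smul_mem _ _ ?_
  have h := raiseKeep_pow_mem_degree (d - k) (k + 1) (derivKeep_pow_mem_degree (d - k) k
    (f := f) (by rwa [Nat.sub_add_cancel hk.le]))
  rwa [show d - k + (k + 1) = d + 1 by omega] at h

lemma integralKeep_mem_filtration (d s : ℕ) {f : MvPolynomial σ K}
    (hf : f ∈ supportFiltration K σ s) : integralKeep K σ d f ∈ supportFiltration K σ s := by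
  have hD : ∀ k, (derivKeep K σ ^ k) f ∈ supportFiltration K σ s := fun k => by
    induction k with
    | zero => simpa using hf
    | succ k ih =>
      rw [pow_succ', Module.End.mul_apply, derivKeep, LinearMap.sum_apply]
      exact Submodule.sum_mem _ fun i _ => pderivKeep_mem_filtration i s ih
  have hF : ∀ k l, (raiseKeep K σ ^ l) ((derivKeep K σ ^ k) f) ∈ supportFiltration K σ s :=
    fun k l => by
      induction l with
      | zero => simpa using hD k
      | succ l ih =>
        rw [pow_succ', Module.End.mul_apply, raiseKeep, LinearMap.sum_apply]
        exact Submodule.sum_mem _ fun i _ => supportedIntegral_mem_filtration i s ih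
  rw [integralKeep, LinearMap.sum_apply]
  exact Submodule.sum_mem _ fun k _ => Submodule.smul_mem _ _ (hF k (k + 1))

variable (K) in
/-- The error made by `integralKeep` as a right inverse of `∑ ∂/∂x_i`. -/
noncomputable def integralError (σ : Type*) [Fintype σ] (d : ℕ) :
    Module.End K (MvPolynomial σ K) :=
  derivDrop K σ * integralKeep K σ d

lemma integralError_mem_degree {d : ℕ} {f : MvPolynomial σ K}
    (hf : f ∈ homogeneousSubmodule σ K d) :
    integralError K σ d f ∈ homogeneousSubmodule σ K d :=
  derivDrop_mem_degree d (integralKeep_mem_degree hf)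

lemma integralError_pow_eq_zero_of_mem (d s : ℕ) {f : MvPolynomial σ K}
    (hf : f ∈ supportFiltration K σ s) : (integralError K σ d ^ (s + 1)) f = 0 := by
  induction s generalizing f with
  | zero =>
    rw [zero_add, pow_one, integralError, Module.End.mul_apply, derivDrop, LinearMap.sum_apply]
    exact Finset.sum_eq_zero fun i _ => pderivDrop_eq_zero i (integralKeep_mem_filtration d 0 hf)
  | succ s ih =>
    rw [pow_succ, Module.End.mul_apply]
    refine ih ?_
    rw [integralError, Module.End.mul_apply, derivDrop, LinearMap.sum_apply]
    exact Submodule.sum_mem _ fun i _ =>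
      pderivDrop_mem_filtration i s (integralKeep_mem_filtration d _ hf)

lemma integralError_pow_eq_zero (d : ℕ) :
    integralError K σ d ^ (Fintype.card σ + 1) = 0 :=
  LinearMap.ext fun _ => integralError_pow_eq_zero_of_mem d _ <|
    (mem_restrictSupport_iff K).2 fun m _ => Finset.card_le_univ m.support

variable (K) in
/-- A right inverse of `∑ ∂/∂x_i` on homogeneous polynomials of degree `d`. -/
noncomputable def homogeneousIntegral (σ : Type*) [Fintype σ] (d : ℕ) :
    Module.End K (MvPolynomial σ K) :=
  integralKeep K σ d * ∑ k ∈ Finset.range (Fintype.card σ + 1), (-integralError K σ d) ^ k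

lemma sum_neg_integralError_pow_mem_degree {d : ℕ} (n : ℕ) {f : MvPolynomial σ K}
    (hf : f ∈ homogeneousSubmodule σ K d) :
    (∑ k ∈ Finset.range n, (-integralError K σ d) ^ k) f ∈ homogeneousSubmodule σ K d := by
  rw [LinearMap.sum_apply]
  refine Submodule.sum_mem _ fun k hk => ?_
  clear hk
  induction k with
  | zero => simpa using hf
  | succ k ih =>
    rw [pow_succ', Module.End.mul_apply, LinearMap.neg_apply]
    exact Submodule.neg_mem _ (integralError_mem_degree ih)

lemma homogeneousIntegral_mem_degree {d : ℕ} {f : MvPolynomial σ K}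
    (hf : f ∈ homogeneousSubmodule σ K d) :
    homogeneousIntegral K σ d f ∈ homogeneousSubmodule σ K (d + 1) :=
  integralKeep_mem_degree (sum_neg_integralError_pow_mem_degree _ hf)

lemma sum_pderiv_homogeneousIntegral {p : ℕ} [CharP K p] (hp : p.Prime) {d : ℕ} (hd : 1 ≤ d)
    (hdp : d + 1 < p) {f : MvPolynomial σ K} (hf : f ∈ homogeneousSubmodule σ K d) :
    (∑ i : σ, (pderiv i).toLinearMap : Module.End K (MvPolynomial σ K))
      (homogeneousIntegral K σ d f) = f := by
  have hg := sum_neg_integralError_pow_mem_degree (Fintype.card σ + 1) hf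
  rw [← derivKeep_add_derivDrop, homogeneousIntegral, Module.End.mul_apply, LinearMap.add_apply,
    derivKeep_integralKeep hp hd hdp hg, ← Module.End.mul_apply (derivDrop K σ)]
  have h := LinearMap.congr_fun
    (mul_neg_geom_sum (-integralError K σ d) (Fintype.card σ + 1)) f
  have hz : (-integralError K σ d) ^ (Fintype.card σ + 1) = 0 :=
    (neg_pow (integralError K σ d) _).trans (by rw [integralError_pow_eq_zero, mul_zero])
  rw [hz, sub_zero, sub_neg_eq_add,
    Module.End.mul_apply, LinearMap.add_apply] at h
  exact h

end SupportPreserving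

section Equivariance

variable {σ K : Type*} [Field K]

variable (K σ) in
/-- The operators commuting with all permutations of the variables. -/
noncomputable def permCommutant : Subalgebra K (Module.End K (MvPolynomial σ K)) :=
  Subalgebra.centralizer K
    (Set.range fun e : Equiv.Perm σ => (rename (R := K) e).toLinearMap)

lemma rename_weightedShift (e : Equiv.Perm σ) {c c' : (σ →₀ ℕ) → K}
    {φ φ' : (σ →₀ ℕ) → (σ →₀ ℕ)} (hc : ∀ m, c' (m.mapDomain e) = c m)
    (hφ : ∀ m, φ' (m.mapDomain e) = (φ m).mapDomain e) :
    (rename (R := K) e).toLinearMap * weightedShift c φ =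
      weightedShift c' φ' * (rename (R := K) e).toLinearMap := by
  refine (basisMonomials σ K).ext fun m => ?_
  simp [weightedShift_monomial, rename_monomial, hc, hφ]

lemma mapDomain_sub_single (e : Equiv.Perm σ) (m : σ →₀ ℕ) (i : σ) :
    m.mapDomain e - Finsupp.single (e i) 1 = (m - Finsupp.single i 1).mapDomain e := by
  classical
  ext j
  obtain ⟨j, rfl⟩ := e.surjective j
  simp [Finsupp.mapDomain_apply e.injective, Finsupp.single_apply]

lemma sum_mem_permCommutant [Fintype σ] {L : σ → Module.End K (MvPolynomial σ K)}
    (h : ∀ (e : Equiv.Perm σ) i, (rename (R := K) e).toLinearMap * L i =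
      L (e i) * (rename (R := K) e).toLinearMap) :
    ∑ i, L i ∈ permCommutant σ K := by
  rw [permCommutant, Subalgebra.mem_centralizer_iff]
  rintro _ ⟨e, rfl⟩
  simp only [Finset.mul_sum, h]
  rw [Equiv.sum_comp e fun i => L i * (rename (R := K) e).toLinearMap, Finset.sum_mul]

variable [Fintype σ]

lemma derivKeep_mem_permCommutant : derivKeep K σ ∈ permCommutant σ K :=
  sum_mem_permCommutant fun e i => rename_weightedShift e
    (fun m => by simp [Finsupp.mapDomain_apply e.injective])
    fun m => mapDomain_sub_single e m i

lemma derivDrop_mem_permCommutant : derivDrop K σ ∈ permCommutant σ K :=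
  sum_mem_permCommutant fun e i => rename_weightedShift e
    (fun m => by simp [Finsupp.mapDomain_apply e.injective])
    fun m => mapDomain_sub_single e m i

lemma raiseKeep_mem_permCommutant : raiseKeep K σ ∈ permCommutant σ K := by
  classical
  exact sum_mem_permCommutant fun e i => rename_weightedShift e
    (fun m => by
      rw [Finsupp.mapDomain_apply e.injective, Finsupp.mapDomain_support_of_injective e.injective,
        Finset.card_image_of_injective _ e.injective])
    fun m => by rw [Finsupp.mapDomain_add, Finsupp.mapDomain_single]

lemma homogeneousIntegral_mem_permCommutant (d : ℕ) :
    homogeneousIntegral K σ d ∈ permCommutant σ K := by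
  have hT : integralKeep K σ d ∈ permCommutant σ K :=
    sum_mem fun k _ => Subalgebra.smul_mem _ (mul_mem (pow_mem raiseKeep_mem_permCommutant _)
      (pow_mem derivKeep_mem_permCommutant _)) _
  exact mul_mem hT (sum_mem fun k _ =>
    pow_mem (neg_mem (mul_mem derivDrop_mem_permCommutant hT)) k)

lemma homogeneousIntegral_rename (d : ℕ) (e : Equiv.Perm σ) (f : MvPolynomial σ K) :
    homogeneousIntegral K σ d (rename e f) = rename e (homogeneousIntegral K σ d f) :=
  (LinearMap.congr_fun ((Subalgebra.mem_centralizer_iff K).1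
    (homogeneousIntegral_mem_permCommutant d) _ ⟨e, rfl⟩) f).symm

end Equivariance

end MvPolynomial

theorem stmt2 {K : Type*} [Field K] {p : ℕ} (hp : p.Prime) [CharP K p]
    {G : Type*} [Group G] {t : ℕ}
    -- the permutation module `V` has permutation basis `x_1,…,x_t`, permuted via `π`
    (π : G →* Equiv.Perm (Fin t))
    {r : ℕ} (hr2 : 2 ≤ r) (hrp : r ≤ p - 1) :
    ∃ θ : MvPolynomial (Fin t) K →ₗ[K] MvPolynomial (Fin t) K,
      (∀ f ∈ homogeneousSubmodule (Fin t) K (r - 1),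
        θ f ∈ homogeneousSubmodule (Fin t) K r) ∧
      (∀ (g : G), ∀ f ∈ homogeneousSubmodule (Fin t) K (r - 1),
        θ (rename (⇑(π g)) f) = rename (⇑(π g)) (θ f)) ∧
      (∀ f ∈ homogeneousSubmodule (Fin t) K (r - 1), Done K t (θ f) = f) := by
  obtain ⟨d, rfl⟩ : ∃ d, r = d + 1 := ⟨r - 1, by omega⟩
  refine ⟨homogeneousIntegral K (Fin t) d, fun f hf => homogeneousIntegral_mem_degree hf,
    fun g f _ => homogeneousIntegral_rename d (π g) f,
    fun f hf => sum_pderiv_homogeneousIntegral hp (by omega) (by omega) hf⟩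
end

section
/- Let a and d be nonnegative integers and let D_a be the K-linear operator Σ_{α ∈ Com_t(a)} x^α · ∂^α/α! on K[x_1, …, x_t]. Then D_a maps every homogeneous polynomial f of degree d to C(d, a)·f, where C(d, a) is the binomial coefficient regarded as an element of K. -/
open MvPolynomial

/-- Interpret a tuple of exponents as a finitely supported function. -/
noncomputable def toFS {t : ℕ} (α : Fin t → ℕ) : Fin t →₀ ℕ :=
  Finsupp.equivFunOnFinite.symm α

/-- Vandermonde's identity for a sum of `t` natural numbers. -/
theorem sum_antidiagonalTuple_prod_choose {t : ℕ} (β : Fin t → ℕ) (a : ℕ) :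
    ∑ α ∈ Finset.Nat.antidiagonalTuple t a, ∏ i, (β i).choose (α i) = (∑ i, β i).choose a := by
  induction t generalizing a with
  | zero => cases a <;> simp
  | succ t ih =>
    rw [Fin.sum_univ_succ, Nat.add_choose_eq]
    simp_rw [← ih, Finset.mul_sum]
    rw [Finset.sum_sigma']
    refine Finset.sum_bij' (fun α _ => ⟨(α 0, ∑ i, Fin.tail α i), Fin.tail α⟩)
      (fun p _ => Fin.cons p.1.1 p.2) ?_ ?_ ?_ ?_ ?_
    · intro α hα
      simpa [Finset.Nat.mem_antidiagonalTuple, Fin.sum_univ_succ, Fin.tail] using hα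
    · rintro ⟨⟨m, n⟩, γ⟩ h
      simp only [Finset.mem_sigma, Finset.HasAntidiagonal.mem_antidiagonal,
        Finset.Nat.mem_antidiagonalTuple] at h
      simp [Finset.Nat.mem_antidiagonalTuple, Fin.sum_univ_succ, h.1, h.2]
    · intro α _
      simp
    · rintro ⟨⟨m, n⟩, γ⟩ h
      simp only [Finset.mem_sigma, Finset.HasAntidiagonal.mem_antidiagonal,
        Finset.Nat.mem_antidiagonalTuple] at h
      simp [h.2]
    · intro α _
      simp [Fin.prod_univ_succ, Fin.tail]

/-- Multiplying the divided-power derivative `∂^α/α!` of a monomial `x^β` by `x^α` gives back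
`x^β`, scaled by a product of binomial coefficients. -/
theorem monomial_toFS_mul_smul_monomial_sub {K : Type*} [Field K] {t : ℕ} (α : Fin t → ℕ)
    (β : Fin t →₀ ℕ) (c : K) :
    monomial (toFS α) (1 : K) *
        ((∏ i, ((β i).choose (α i) : K)) • monomial (toFS fun i => β i - α i) c) =
      (∏ i, ((β i).choose (α i) : K)) • monomial β c := by
  by_cases h : ∀ i, α i ≤ β i
  · have hβ : toFS α + toFS (fun i => β i - α i) = β := by
      ext i
      simp [toFS, h i]
    rw [mul_smul_comm, monomial_mul, one_mul, hβ]
  · push Not at h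
    obtain ⟨i, hi⟩ := h
    have h0 : ∏ i, ((β i).choose (α i) : K) = 0 :=
      Finset.prod_eq_zero (Finset.mem_univ i) (by simp [Nat.choose_eq_zero_of_lt hi])
    simp [h0]

theorem stmt3 {K : Type*} [Field K] {t : ℕ} (a d : ℕ)
    -- `Dop α` is the divided-power differential operator `∂^α/α!`
    (Dop : (Fin t → ℕ) → (MvPolynomial (Fin t) K →ₗ[K] MvPolynomial (Fin t) K))
    (hDop : ∀ (α : Fin t → ℕ) (β : Fin t →₀ ℕ) (cc : K),
      Dop α (monomial β cc) =
        (∏ i, ((β i).choose (α i) : K)) • monomial (toFS fun i => β i - α i) cc)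
    (f : MvPolynomial (Fin t) K) (hf : f ∈ homogeneousSubmodule (Fin t) K d) :
    (∑ α ∈ Finset.Nat.antidiagonalTuple t a,
        (LinearMap.mulLeft K (monomial (toFS α) (1 : K))).comp (Dop α)) f
      = (d.choose a : K) • f := by
  rw [f.as_sum, map_sum, Finset.smul_sum]
  refine Finset.sum_congr rfl fun β hβ => ?_
  have hd : ∑ i, β i = d := by
    rw [← Finsupp.degree_eq_sum, Finsupp.degree_eq_weight_one]
    exact hf (mem_support_iff.mp hβ)
  simp only [LinearMap.sum_apply, LinearMap.comp_apply, LinearMap.mulLeft_apply, hDop,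
    monomial_toFS_mul_smul_monomial_sub]
  rw [← Finset.sum_smul, ← hd, ← sum_antidiagonalTuple_prod_choose]
  push_cast
  rfl
end

section
/- Let r be a positive integer, let ι: K → V be an injective KG-homomorphism, and let φ: Sym^r V → Sym^{r−1} V be a KG-module homomorphism with φ ∘ mul_{r−1} = id. Define Ψ(φ) to be the K-linear operator Σ_{α ∈ Com_t(r)} φ(x^α) · ∂^α/α! on K[x_1, …, x_t]. Then the commutator Ψ(φ) ∘ mul − mul ∘ Ψ(φ) maps every homogeneous polynomial f of degree d to C(d, r−1)·f, where C(d, r−1) is the binomial coefficient regarded as an element of K. -/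
open MvPolynomial

/-- **Vandermonde's identity** for finitely many summands. -/
theorem sum_piAntidiag_prod_choose {ι : Type*} [DecidableEq ι] (s : Finset ι) (γ : ι → ℕ) (n : ℕ) :
    ∑ β ∈ s.piAntidiag n, ∏ i ∈ s, (γ i).choose (β i) = (∑ i ∈ s, γ i).choose n := by
  induction s using Finset.cons_induction generalizing n with
  | empty => cases n <;> simp
  | cons a s has ih =>
    rw [Finset.sum_cons, Finset.piAntidiag_cons, Finset.sum_disjiUnion, Nat.add_choose_eq]
    refine Finset.sum_congr rfl fun p _ => ?_
    rw [Finset.sum_map, ← ih, Finset.mul_sum]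
    refine Finset.sum_congr rfl fun β hβ => ?_
    rw [Finset.mem_piAntidiag] at hβ
    have hβa : β a = 0 := not_imp_comm.1 (hβ.2 a) has
    rw [Finset.prod_cons]
    congr 1
    · simp [hβa]
    · refine Finset.prod_congr rfl fun i hi => ?_
      have hia : i ≠ a := ne_of_mem_of_not_mem hi has
      simp [hia]

/-- Reindexing the tuples of sum `n + 1` with a positive `i`-th entry by the tuples of sum `n`. -/
theorem sum_antidiagonalTuple_succ_of_eq_zero {M : Type*} [AddCommMonoid M] {t : ℕ} (i : Fin t)
    (n : ℕ) (F : (Fin t → ℕ) → M) (hF : ∀ α, α i = 0 → F α = 0) :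
    ∑ α ∈ Finset.Nat.antidiagonalTuple t (n + 1), F α =
      ∑ β ∈ Finset.Nat.antidiagonalTuple t n, F (β + Pi.single i 1) := by
  symm
  refine Finset.sum_of_injOn (fun β => β + Pi.single i 1) ?_ ?_ ?_ fun _ _ => rfl
  · exact fun _ _ _ _ h => add_right_cancel h
  · intro β hβ
    rw [Finset.mem_coe, Finset.Nat.mem_antidiagonalTuple] at hβ ⊢
    simp [Finset.sum_add_distrib, hβ]
  · intro α hα hα'
    by_contra hne
    have hle : Pi.single i 1 ≤ α := by
      intro j
      obtain rfl | hij := eq_or_ne i j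
      · simpa [Nat.one_le_iff_ne_zero] using fun h => hne (hF α h)
      · simp [hij.symm]
    refine hα' ⟨α - Pi.single i 1, ?_, tsub_add_cancel_of_le hle⟩
    rw [Finset.mem_coe, Finset.Nat.mem_antidiagonalTuple]
    rw [Finset.Nat.mem_antidiagonalTuple, ← tsub_add_cancel_of_le hle] at hα
    simpa [Finset.sum_add_distrib] using hα

section DividedPowers

variable {K : Type*} [Field K] {t : ℕ}

theorem toFS_add_single (β : Fin t → ℕ) (i : Fin t) :
    toFS (β + Pi.single i 1) = toFS β + Finsupp.single i 1 := by
  ext j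
  simp [toFS, Finsupp.single_apply, Pi.single_apply, eq_comm]

/-- `D α` acts on monomials as the divided-power differential operator `∂^α/α!`. -/
def IsDividedPowerDerivative
    (D : (Fin t → ℕ) → (MvPolynomial (Fin t) K →ₗ[K] MvPolynomial (Fin t) K)) : Prop :=
  ∀ (α : Fin t → ℕ) (β : Fin t →₀ ℕ) (c : K),
    D α (monomial β c) = (∏ i, ((β i).choose (α i) : K)) • monomial (toFS fun i => β i - α i) c

variable {D : (Fin t → ℕ) → (MvPolynomial (Fin t) K →ₗ[K] MvPolynomial (Fin t) K)}

theorem IsDividedPowerDerivative.X_mul_of_eq_zero (hD : IsDividedPowerDerivative D)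
    {α : Fin t → ℕ} {i : Fin t} (hα : α i = 0) (f : MvPolynomial (Fin t) K) :
    D α (X i * f) = X i * D α f := by
  induction f using MvPolynomial.induction_on' with
  | add f g hf hg => simp only [mul_add, map_add, hf, hg]
  | monomial γ c =>
    rw [X, monomial_mul, one_mul, hD, hD, mul_smul_comm, monomial_mul, one_mul]
    have hexp : (toFS fun j => (Finsupp.single i 1 + γ : Fin t →₀ ℕ) j - α j) =
        Finsupp.single i 1 + toFS fun j => γ j - α j := by
      ext j
      obtain rfl | hij := eq_or_ne i j
      · simp [toFS, hα]
      · simp [toFS, hij.symm]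
    rw [hexp]
    congr 1
    refine Finset.prod_congr rfl fun j _ => ?_
    obtain rfl | hij := eq_or_ne i j
    · simp [hα]
    · simp [hij.symm]

theorem IsDividedPowerDerivative.X_mul_add_single (hD : IsDividedPowerDerivative D)
    (β : Fin t → ℕ) (i : Fin t) (f : MvPolynomial (Fin t) K) :
    D (β + Pi.single i 1) (X i * f) = X i * D (β + Pi.single i 1) f + D β f := by
  induction f using MvPolynomial.induction_on' with
  | add f g hf hg => simp only [mul_add, map_add, hf, hg]; abel
  | monomial γ c =>
    rw [X, monomial_mul, one_mul, hD, hD, hD, mul_smul_comm, monomial_mul, one_mul]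
    have hexp : (toFS fun j => (Finsupp.single i 1 + γ : Fin t →₀ ℕ) j - (β + Pi.single i 1 : Fin t → ℕ) j) =
        toFS fun j => γ j - β j := by
      ext j
      obtain rfl | hij := eq_or_ne i j
      · simp [toFS, add_comm 1 (γ i)]
      · simp [toFS, hij.symm]
    have hprod (m k : Fin t → ℕ) (hm : ∀ j ≠ i, m j = γ j) (hk : ∀ j ≠ i, k j = β j) :
        (∏ j, ((m j).choose (k j) : K)) =
          (m i).choose (k i) * ∏ j ∈ Finset.univ.erase i, ((γ j).choose (β j) : K) := by
      rw [← Finset.mul_prod_erase _ _ (Finset.mem_univ i)]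
      congr 1
      refine Finset.prod_congr rfl fun j hj => ?_
      rw [hm j (Finset.ne_of_mem_erase hj), hk j (Finset.ne_of_mem_erase hj)]
    have hβ : ∀ j ≠ i, (β + Pi.single i 1 : Fin t → ℕ) j = β j := fun j hj => by simp [hj]
    have hγ : ∀ j ≠ i, (Finsupp.single i 1 + γ : Fin t →₀ ℕ) j = γ j := fun j hj => by simp [hj]
    rw [hexp, hprod _ _ hγ hβ, hprod γ _ (fun _ _ => rfl) hβ,
      hprod γ β (fun _ _ => rfl) fun _ _ => rfl]
    simp only [Finsupp.add_apply, Finsupp.single_eq_same, Pi.add_apply, Pi.single_eq_same,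
      add_comm 1 (γ i), Nat.choose_succ_succ]
    obtain hlt | hle := lt_or_ge (β i) (γ i)
    · have hexp' : (Finsupp.single i 1 + toFS fun j => γ j - (β j + Pi.single (M := fun _ => ℕ) i 1 j)) =
          toFS fun j => γ j - β j := by
        ext j
        obtain rfl | hij := eq_or_ne i j
        · simp [toFS]; omega
        · simp [toFS, hij.symm]
      rw [hexp', ← add_smul]
      push_cast
      congr 1
      ring
    · simp [Nat.choose_eq_zero_of_lt (Nat.lt_succ_of_le hle)]

/-- The commutator of `∑ φ(x^α) ∂^α/α!`, over `α` of sum `n + 1`, with multiplication by a linear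
form `w` is `∑ φ(w x^β) ∂^β/β!`, over `β` of sum `n`. -/
theorem IsDividedPowerDerivative.sum_commutator (hD : IsDividedPowerDerivative D)
    (φ : MvPolynomial (Fin t) K →ₗ[K] MvPolynomial (Fin t) K) (n : ℕ)
    {w : MvPolynomial (Fin t) K} (hw : w ∈ homogeneousSubmodule (Fin t) K 1)
    (f : MvPolynomial (Fin t) K) :
    ∑ α ∈ Finset.Nat.antidiagonalTuple t (n + 1),
        φ (monomial (toFS α) 1) * (D α (w * f) - w * D α f) =
      ∑ β ∈ Finset.Nat.antidiagonalTuple t n, φ (w * monomial (toFS β) 1) * D β f := by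
  rw [homogeneousSubmodule_one_eq_span_X] at hw
  induction hw using Submodule.span_induction with
  | mem w hw =>
    obtain ⟨i, rfl⟩ := hw
    rw [sum_antidiagonalTuple_succ_of_eq_zero i]
    · refine Finset.sum_congr rfl fun β _ => ?_
      rw [hD.X_mul_add_single, add_sub_cancel_left, toFS_add_single, X, monomial_mul, one_mul,
        add_comm]
    · intro α hα
      rw [hD.X_mul_of_eq_zero hα, sub_self, mul_zero]
  | zero => simp
  | add u v _ _ hu hv =>
    simp only [add_mul, map_add, Finset.sum_add_distrib, ← hu, ← hv]
    rw [← Finset.sum_add_distrib]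
    exact Finset.sum_congr rfl fun α _ => by ring
  | smul c u _ hu =>
    simp only [smul_mul_assoc, map_smul, ← smul_sub, mul_smul_comm, ← Finset.smul_sum, hu]

theorem IsDividedPowerDerivative.sum_monomial_mul (hD : IsDividedPowerDerivative D) (n : ℕ)
    (γ : Fin t →₀ ℕ) (c : K) :
    ∑ β ∈ Finset.Nat.antidiagonalTuple t n, monomial (toFS β) 1 * D β (monomial γ c) =
      (γ.degree.choose n : K) • monomial γ c := by
  have hterm (β : Fin t → ℕ) : monomial (toFS β) 1 * D β (monomial γ c) =
      ((∏ i, (γ i).choose (β i) : ℕ) : K) • monomial γ c := by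
    rw [hD, mul_smul_comm, monomial_mul, one_mul, Nat.cast_prod]
    by_cases hle : ∀ i, β i ≤ γ i
    · have hexp : (toFS β + toFS fun i => γ i - β i) = γ := by
        ext i
        simp [toFS, hle i]
      rw [hexp]
    · push Not at hle
      obtain ⟨i, hi⟩ := hle
      rw [Finset.prod_eq_zero (Finset.mem_univ i) (by simp [Nat.choose_eq_zero_of_lt hi]),
        zero_smul, zero_smul]
  rw [Finset.sum_congr rfl fun β _ => hterm β, ← Finset.sum_smul, ← Nat.cast_sum,
    ← Finset.piAntidiag_univ_fin_eq_antidiagonalTuple, sum_piAntidiag_prod_choose,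
    Finsupp.degree_eq_sum]

theorem IsDividedPowerDerivative.sum_monomial_mul_of_isHomogeneous
    (hD : IsDividedPowerDerivative D) (n : ℕ) {d : ℕ} {f : MvPolynomial (Fin t) K}
    (hf : f.IsHomogeneous d) :
    ∑ β ∈ Finset.Nat.antidiagonalTuple t n, monomial (toFS β) 1 * D β f =
      (d.choose n : K) • f := by
  conv_lhs => rw [f.as_sum]
  conv_rhs => rw [f.as_sum]
  simp only [map_sum, Finset.mul_sum]
  rw [Finset.sum_comm, Finset.smul_sum]
  refine Finset.sum_congr rfl fun γ hγ => ?_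
  rw [hD.sum_monomial_mul, hf.degree_eq_sum_deg_support hγ, Finsupp.degree]
  rfl

end DividedPowers

theorem stmt5 {K : Type*} [Field K] {p : ℕ} (hp : p.Prime) [CharP K p]
    {G : Type*} [Group G] {t : ℕ}
    (ρ : G →* (MvPolynomial (Fin t) K ≃ₐ[K] MvPolynomial (Fin t) K))
    (hρ : ∀ (g : G) (i : Fin t), (ρ g) (X i) ∈ homogeneousSubmodule (Fin t) K 1)
    -- `w₀ = ι(1)`, the image of `1 ∈ K` under the injective `KG`-map `ι : K → V`
    (w₀ : MvPolynomial (Fin t) K) (hw₀ : w₀ ∈ homogeneousSubmodule (Fin t) K 1)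
    (hw₀ne : w₀ ≠ 0) (hw₀inv : ∀ g : G, (ρ g) w₀ = w₀)
    {r : ℕ} (hr : 0 < r)
    (φ : MvPolynomial (Fin t) K →ₗ[K] MvPolynomial (Fin t) K)
    (hφmem : ∀ f ∈ homogeneousSubmodule (Fin t) K r,
      φ f ∈ homogeneousSubmodule (Fin t) K (r - 1))
    (hφequiv : ∀ (g : G), ∀ f ∈ homogeneousSubmodule (Fin t) K r,
      φ ((ρ g) f) = (ρ g) (φ f))
    (hφsplit : ∀ f ∈ homogeneousSubmodule (Fin t) K (r - 1), φ (w₀ * f) = f)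
    -- `Dop α` is the divided-power differential operator `∂^α/α!`
    (Dop : (Fin t → ℕ) → (MvPolynomial (Fin t) K →ₗ[K] MvPolynomial (Fin t) K))
    (hDop : ∀ (α : Fin t → ℕ) (β : Fin t →₀ ℕ) (cc : K),
      Dop α (monomial β cc) =
        (∏ i, ((β i).choose (α i) : K)) • monomial (toFS fun i => β i - α i) cc)
    -- `Ψ(φ) = Σ_{α ∈ Com_t(r)} φ(x^α)·∂^α/α!`
    (Ψ : MvPolynomial (Fin t) K →ₗ[K] MvPolynomial (Fin t) K)
    (hΨ : Ψ = ∑ α ∈ Finset.Nat.antidiagonalTuple t r,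
      (LinearMap.mulLeft K (φ (monomial (toFS α) (1 : K)))).comp (Dop α)) :
    ∀ (d : ℕ), ∀ f ∈ homogeneousSubmodule (Fin t) K d,
      (Ψ.comp (LinearMap.mulLeft K w₀) - (LinearMap.mulLeft K w₀).comp Ψ) f
        = (d.choose (r - 1) : K) • f := by
  intro d f hf
  have hD : IsDividedPowerDerivative Dop := hDop
  obtain ⟨n, rfl⟩ : ∃ n, r = n + 1 := ⟨r - 1, by omega⟩
  rw [Nat.add_sub_cancel] at hφsplit ⊢
  have hcomm : (Ψ.comp (LinearMap.mulLeft K w₀) - (LinearMap.mulLeft K w₀).comp Ψ) f =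
      ∑ α ∈ Finset.Nat.antidiagonalTuple t (n + 1),
        φ (monomial (toFS α) 1) * (Dop α (w₀ * f) - w₀ * Dop α f) := by
    simp only [hΨ, LinearMap.sub_apply, LinearMap.comp_apply, LinearMap.sum_apply,
      LinearMap.mulLeft_apply, Finset.mul_sum, ← Finset.sum_sub_distrib]
    exact Finset.sum_congr rfl fun α _ => by ring
  rw [hcomm, hD.sum_commutator φ n hw₀, ← hD.sum_monomial_mul_of_isHomogeneous n hf]
  refine Finset.sum_congr rfl fun β hβ => ?_
  rw [hφsplit _ (isHomogeneous_monomial 1 ?_)]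
  rw [Finset.Nat.mem_antidiagonalTuple] at hβ
  rw [Finsupp.degree_eq_sum, ← hβ]
  rfl
end

section
/- Let r < n be positive integers and let λ be a partition of n with largest part λ_1. If either (i) y_r^λ ≠ 0, or (ii) r ≥ 2 and y_r^λ − y_{r−1}^λ ≠ 0, or (iii) r ≥ 3 and y_r^λ + y_{r−2}^λ − 2·y_{r−1}^λ ≠ 0, then n − r ≤ λ_1 < n. -/
/-- `y_r^λ`: the number of sequences `d = (d_0, d_1, …)` of nonnegative integers whose
multiset of nonzero entries is the multiset of parts of `λ` and with `Σ_i i·d_i = r`. -/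
noncomputable def ycount {n : ℕ} (lam : n.Partition) (r : ℕ) : ℕ :=
  Nat.card {d : ℕ →₀ ℕ //
    Multiset.map (⇑d) d.support.val = lam.parts ∧ d.sum (fun i m => i * m) = r}

/-- If some sequence counted by `ycount lam s` exists with `0 < s < n`, then the largest part of
`lam` lies in `[n - s, n)`. -/
theorem sup_parts_bounds_of_ycount_ne_zero {n s : ℕ} (hs : 0 < s) (hsn : s < n)
    (lam : n.Partition) (h : ycount lam s ≠ 0) :
    n - s ≤ lam.parts.sup ∧ lam.parts.sup < n := by
  obtain ⟨⟨d, hd, hds⟩⟩ := (Nat.card_ne_zero.mp h).1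
  have hmem : ∀ i, d i ≠ 0 → d i ∈ lam.parts := fun i hi => by
    rw [← hd]
    exact Multiset.mem_map_of_mem _ (Finsupp.mem_support_iff.mpr hi)
  have hsum : ∑ i ∈ d.support, d i = n := by
    rw [Finset.sum_eq_multiset_sum, hd, lam.parts_sum]
  have hweight : ∑ i ∈ d.support, i * d i = s := hds
  have hle : n ≤ d 0 + s := by
    calc n = ∑ i ∈ d.support, d i := hsum.symm
      _ ≤ ∑ i ∈ d.support, ((if i = 0 then d 0 else 0) + i * d i) := by
        refine Finset.sum_le_sum fun i _ => ?_
        rcases Nat.eq_zero_or_pos i with rfl | hi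
        · simp
        · exact (Nat.le_mul_of_pos_left _ hi).trans (Nat.le_add_left _ _)
      _ ≤ d 0 + s := by
        rw [Finset.sum_add_distrib, hweight, Finset.sum_ite_eq']
        split_ifs <;> omega
  have hzero : d 0 ≠ 0 := by omega
  refine ⟨(by omega : n - s ≤ d 0).trans (Multiset.le_sup (hmem 0 hzero)), ?_⟩
  rw [← hd, ← Finset.sup_def, Finset.sup_lt_iff (hs.trans hsn)]
  intro j hj
  rcases Nat.eq_zero_or_pos j with rfl | hjpos
  · obtain ⟨i, hi, hne⟩ := Finset.exists_ne_zero_of_sum_ne_zero (hweight.trans_ne hs.ne')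
    have hi0 : i ≠ 0 := left_ne_zero_of_mul hne
    rw [← hsum]
    exact Finset.single_lt_sum hi0 hj hi (Nat.pos_of_ne_zero (right_ne_zero_of_mul hne))
      fun _ _ _ => Nat.zero_le _
  · calc d j ≤ j * d j := Nat.le_mul_of_pos_left _ hjpos
      _ ≤ ∑ i ∈ d.support, i * d i :=
        Finset.single_le_sum (f := fun i => i * d i) (fun _ _ => Nat.zero_le _) hj
      _ < n := hweight.trans_lt hsn

theorem stmt12 {n r : ℕ} (hr : 0 < r) (hrn : r < n) (lam : n.Partition)
    (h : ycount lam r ≠ 0 ∨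
      (2 ≤ r ∧ (ycount lam r : ℤ) - ycount lam (r - 1) ≠ 0) ∨
      (3 ≤ r ∧ (ycount lam r : ℤ) + ycount lam (r - 2) - 2 * ycount lam (r - 1) ≠ 0)) :
    n - r ≤ lam.parts.sup ∧ lam.parts.sup < n := by
  obtain ⟨s, hs, hsr, hne⟩ : ∃ s, 0 < s ∧ s ≤ r ∧ ycount lam s ≠ 0 := by
    by_contra! hall
    have hyr := hall r hr le_rfl
    rcases h with h | ⟨h2, h⟩ | ⟨h3, h⟩
    · exact h hyr
    · simp [hyr, hall (r - 1) (by omega) (by omega)] at h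
    · simp [hyr, hall (r - 1) (by omega) (by omega), hall (r - 2) (by omega) (by omega)] at h
  have hbounds := sup_parts_bounds_of_ycount_ne_zero hs (hsr.trans_lt hrn) lam hne
  exact ⟨(Nat.sub_le_sub_left hsr n).trans hbounds.1, hbounds.2⟩
end
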